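/- Assume that ∂X_t = ∪_{i=1}^{n_X} {x ∈ X_t : g_i(x,t) = 0} for every t ∈ [0,T], that ∂TR = ∪_{j=1}^{n_TR} {x ∈ TR : l_j(x) = 0}, and that for every x ∈ ℝ^n the supremum defining u(x,0) is attained by some admissible uncertainty on [0,T]. Let ℛ_0 := {x ∈ ℝ^n : u(x,0) ≤ 0}, and let (ψ_k)_{k∈ℕ} be a sequence of continuous functions on B with ψ_k(x) > u(x,0) for every x ∈ B and sup_{x∈B} |ψ_k(x) − u(x,0)| → 0 as k → ∞. Set X_{0k} := {x ∈ X_0 : ψ_k(x) ≤ 0}. Then lim_{k→∞} μ(ℛ_0 \ X_{0k}) = μ(∂ℛ_0), where μ is the Lebesgue measure on ℝ^n and ∂ℛ_0 = {x ∈ ℝ^n : u(x,0) = 0} is the topological boundary of ℛ_0. -/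

import Mathlib

open Set MeasureTheory RealInnerProductSpace Filter Topology

noncomputable section

abbrev EucSp (n : ℕ) : Type := EuclideanSpace ℝ (Fin n)

/-- An admissible uncertainty on `[t, T]`: a measurable map taking values in `D` there. -/
def Admissible {m : ℕ} (D : Set (EucSp m)) (t T : ℝ) (d : ℝ → EucSp m) : Prop :=
  Measurable d ∧ ∀ s ∈ Set.Icc t T, d s ∈ D

/-- `y` solves `ẏ(s) = F (y s) (d s)` on `[t, T]` with `y t = x` (integral form,
equivalent to absolute continuity together with the a.e. differential equation). -/
def IsTraj {n m : ℕ} (F : EucSp n → EucSp m → EucSp n) (d : ℝ → EucSp m)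
    (t T : ℝ) (x : EucSp n) (y : ℝ → EucSp n) : Prop :=
  y t = x ∧ ∀ s ∈ Set.Icc t T, y s = x + ∫ r in t..s, F (y r) (d r)

/-- The payoff of a trajectory `y` on `[t, T]`:
`max { max_j l_j (y T), max_i sup_{s ∈ [t,T]} g_i (y s, s) }`. -/
def payoff {n nX nTR : ℕ} (g : Fin nX → EucSp n → ℝ → ℝ) (l : Fin nTR → EucSp n → ℝ)
    (t T : ℝ) (y : ℝ → EucSp n) : ℝ :=
  max (⨆ j, l j (y T)) (⨆ i, sSup ((fun s => g i (y s) s) '' Set.Icc t T))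

/-- The defining property of the value function `u`: for `(x, t) ∈ ℝⁿ × [0, T]`,
`u (x, t)` is the supremum of the payoffs over all admissible uncertainties on `[t, T]`
(the trajectory being the unique solution of the ODE driven by the uncertainty). -/
def IsValueFun {n m nX nTR : ℕ} (F : EucSp n → EucSp m → EucSp n) (D : Set (EucSp m))
    (g : Fin nX → EucSp n → ℝ → ℝ) (l : Fin nTR → EucSp n → ℝ) (T : ℝ)
    (u : EucSp n → ℝ → ℝ) : Prop :=
  ∀ x : EucSp n, ∀ t ∈ Set.Icc (0:ℝ) T,
    u x t = sSup {r | ∃ d y, Admissible D t T d ∧ IsTraj F d t T x y ∧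
      r = payoff g l t T y}

/-- The Hamiltonian `H(x, p) = max_{d ∈ D} ⟪p, F x d⟫`. -/
def Ham {n m : ℕ} (F : EucSp n → EucSp m → EucSp n) (D : Set (EucSp m))
    (x p : EucSp n) : ℝ :=
  sSup ((fun d => ⟪p, F x d⟫) '' D)

/-- Viscosity super-solution of `max{∂ₜ w + H(x, ∇ₓ w), maxᵢ gᵢ(x,t) - w} = 0` on
`ℝⁿ × [0, T]`: a lower semicontinuous function such that for every smooth test function
`ψ` such that `w - ψ` attains a local minimum at `(x₀, t₀) ∈ ℝⁿ × [0, T]`, one has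
`max{∂ₜ ψ(x₀,t₀) + H(x₀, ∇ₓ ψ(x₀,t₀)), maxᵢ gᵢ(x₀,t₀) - w(x₀,t₀)} ≤ 0`. -/
def ViscSuper {n m nX : ℕ} (F : EucSp n → EucSp m → EucSp n) (D : Set (EucSp m))
    (g : Fin nX → EucSp n → ℝ → ℝ) (T : ℝ) (w : EucSp n → ℝ → ℝ) : Prop :=
  LowerSemicontinuousOn (fun p : EucSp n × ℝ => w p.1 p.2) (Set.univ ×ˢ Set.Icc 0 T) ∧
  ∀ ψ : EucSp n → ℝ → ℝ, ContDiff ℝ (⊤ : ℕ∞) (fun p : EucSp n × ℝ => ψ p.1 p.2) →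
    ∀ x₀ : EucSp n, ∀ t₀ ∈ Set.Icc (0:ℝ) T,
      IsLocalMinOn (fun p : EucSp n × ℝ => w p.1 p.2 - ψ p.1 p.2)
        (Set.univ ×ˢ Set.Icc 0 T) (x₀, t₀) →
      max (deriv (ψ x₀) t₀ + Ham F D x₀ (gradient (fun z => ψ z t₀) x₀))
        ((⨆ i, g i x₀ t₀) - w x₀ t₀) ≤ 0

/-- Viscosity sub-solution of `max{∂ₜ w + H(x, ∇ₓ w), maxᵢ gᵢ(x,t) - w} = 0` on
`ℝⁿ × [0, T]`. -/
def ViscSub {n m nX : ℕ} (F : EucSp n → EucSp m → EucSp n) (D : Set (EucSp m))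
    (g : Fin nX → EucSp n → ℝ → ℝ) (T : ℝ) (w : EucSp n → ℝ → ℝ) : Prop :=
  UpperSemicontinuousOn (fun p : EucSp n × ℝ => w p.1 p.2) (Set.univ ×ˢ Set.Icc 0 T) ∧
  ∀ ψ : EucSp n → ℝ → ℝ, ContDiff ℝ (⊤ : ℕ∞) (fun p : EucSp n × ℝ => ψ p.1 p.2) →
    ∀ x₀ : EucSp n, ∀ t₀ ∈ Set.Icc (0:ℝ) T,
      IsLocalMaxOn (fun p : EucSp n × ℝ => w p.1 p.2 - ψ p.1 p.2)
        (Set.univ ×ˢ Set.Icc 0 T) (x₀, t₀) →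
      0 ≤ max (deriv (ψ x₀) t₀ + Ham F D x₀ (gradient (fun z => ψ z t₀) x₀))
        ((⨆ i, g i x₀ t₀) - w x₀ t₀)

/-- The backward reachable set at time `t` (horizon `T`) of the target `{maxⱼ lⱼ ≤ 0}`
under state constraints `{maxᵢ gᵢ(·, s) ≤ 0}`, for the dynamics `f` driven by
uncertainties in `D`: the set of `x` such that for every admissible uncertainty the
(unique) solution extends to all of `[t, T]`, respects the state constraints there,
and ends up in the target at time `T`. -/
def Reach {n m nX nTR : ℕ} (f : EucSp n → EucSp m → EucSp n) (D : Set (EucSp m))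
    (g : Fin nX → EucSp n → ℝ → ℝ) (l : Fin nTR → EucSp n → ℝ)
    (t T : ℝ) : Set (EucSp n) :=
  {x | ∀ d, Admissible D t T d → ∃ y, IsTraj f d t T x y ∧
    (∀ s ∈ Set.Icc t T, ∀ i, g i (y s) s ≤ 0) ∧ ∀ j, l j (y T) ≤ 0}

/-- Integral form of Grönwall's inequality, in both time directions. -/
theorem le_mul_exp_of_le_add_mul_abs_integral {w : ℝ → ℝ} {δ L a b : ℝ} (hδ : 0 ≤ δ) (hL : 0 ≤ L)
    (hw : ContinuousOn w (uIcc a b)) (hw0 : ∀ s ∈ uIcc a b, 0 ≤ w s)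
    (h : ∀ s ∈ uIcc a b, w s ≤ δ + L * |∫ r in a..s, w r|) :
    w b ≤ δ * Real.exp (L * |b - a|) := by
  set p : ℝ → ℝ := fun τ => a + (b - a) * τ with hp
  have hpmem : ∀ τ ∈ Icc (0 : ℝ) 1, p τ ∈ uIcc a b := by
    intro τ hτ
    rw [← segment_eq_uIcc, segment_eq_image']
    exact ⟨τ, hτ, by simp [hp, mul_comm]⟩
  set v : ℝ → ℝ := IccExtend zero_le_one ((Icc (0 : ℝ) 1).domRestrict (w ∘ p)) with hv
  have hvw : ∀ τ ∈ Icc (0 : ℝ) 1, v τ = w (p τ) := fun τ hτ => by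
    rw [hv, IccExtend_of_mem _ _ hτ, domRestrict_apply, Function.comp_apply]
  have hvc : Continuous v := by
    refine (ContinuousOn.domRestrict ?_).Icc_extend'
    exact hw.comp (by fun_prop) hpmem
  have hv0 : ∀ τ, 0 ≤ v τ := fun τ => hw0 _ (hpmem _ (projIcc 0 1 zero_le_one τ).2)
  set K := L * |b - a| with hK
  have hK0 : 0 ≤ K := by positivity
  have hint0 : ∀ τ, 0 ≤ τ → 0 ≤ ∫ r in (0 : ℝ)..τ, v r := fun τ hτ =>
    intervalIntegral.integral_nonneg hτ fun r _ => hv0 r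
  have hvle : ∀ τ ∈ Icc (0 : ℝ) 1, v τ ≤ δ + K * ∫ r in (0 : ℝ)..τ, v r := by
    intro τ hτ
    have h1 := h (p τ) (hpmem τ hτ)
    have h2 : ∫ r in a..p τ, w r = (b - a) * ∫ r in (0 : ℝ)..τ, v r := by
      have h3 := intervalIntegral.smul_integral_comp_add_mul (a := 0) (b := τ) w (b - a) a
      rw [mul_zero, add_zero] at h3
      rw [← h3, smul_eq_mul]
      congr 1
      refine intervalIntegral.integral_congr fun r hr => ?_
      rw [uIcc_of_le hτ.1] at hr
      exact (hvw r ⟨hr.1, hr.2.trans hτ.2⟩).symm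
    rw [h2, abs_mul, abs_of_nonneg (hint0 τ hτ.1), ← mul_assoc] at h1
    rw [hvw τ hτ]
    exact h1
  have hderiv : ∀ τ, HasDerivAt (fun τ => δ + K * ∫ r in (0 : ℝ)..τ, v r) (K * v τ) τ :=
    fun τ => ((hvc.integral_hasStrictDerivAt 0 τ).hasDerivAt.const_mul K).const_add δ
  have hG0 : ∀ τ ∈ Icc (0 : ℝ) 1, 0 ≤ δ + K * ∫ r in (0 : ℝ)..τ, v r := fun τ hτ =>
    add_nonneg hδ (mul_nonneg hK0 (hint0 τ hτ.1))
  have key := norm_le_gronwallBound_of_norm_deriv_right_le (δ := δ) (K := K) (ε := 0)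
    (a := 0) (b := 1)
    (fun τ _ => (hderiv τ).continuousAt.continuousWithinAt)
    (fun τ _ => (hderiv τ).hasDerivWithinAt) (by simp [abs_of_nonneg hδ])
    (fun τ hτ => by
      rw [Real.norm_eq_abs, Real.norm_eq_abs, abs_of_nonneg (mul_nonneg hK0 (hv0 τ)), add_zero,
        abs_of_nonneg (hG0 τ (Ico_subset_Icc_self hτ))]
      exact mul_le_mul_of_nonneg_left (hvle τ (Ico_subset_Icc_self hτ)) hK0)
    1 (right_mem_Icc.2 zero_le_one)
  rw [gronwallBound_ε0, sub_zero, mul_one, Real.norm_eq_abs] at key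
  have h1 := hvle 1 (right_mem_Icc.2 zero_le_one)
  rw [hvw 1 (right_mem_Icc.2 zero_le_one)] at h1
  have hp1 : p 1 = b := by simp [hp]
  rw [hp1] at h1
  exact h1.trans ((le_abs_self _).trans key)

/-- A time-dependent vector field that is jointly measurable, Lipschitz in space uniformly in time,
and bounded in time at the origin. -/
structure IsLipschitzField {E : Type*} [NormedAddCommGroup E] [MeasurableSpace E]
    (f : ℝ → E → E) (L C : ℝ) : Prop where
  measurable : Measurable (Function.uncurry f)
  lipschitz : ∀ t x y, ‖f t x - f t y‖ ≤ L * ‖x - y‖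
  norm_zero_le : ∀ t, ‖f t 0‖ ≤ C

namespace IsLipschitzField

variable {E : Type*} [NormedAddCommGroup E] [MeasurableSpace E] {f : ℝ → E → E} {L C : ℝ}

theorem norm_le (hf : IsLipschitzField f L C) (t : ℝ) (x : E) : ‖f t x‖ ≤ C + L * ‖x‖ := by
  have h1 := hf.lipschitz t x 0
  rw [sub_zero] at h1
  have h2 := norm_add_le (f t x - f t 0) (f t 0)
  rw [sub_add_cancel] at h2
  linarith [hf.norm_zero_le t]

theorem integrableOn [BorelSpace E] [SecondCountableTopology E] (hf : IsLipschitzField f L C)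
    (hL : 0 ≤ L) {y : ℝ → E} {a b M : ℝ} (hy : Measurable y) (hM : ∀ s ∈ Icc a b, ‖y s‖ ≤ M) :
    IntegrableOn (fun r => f r (y r)) (Icc a b) := by
  refine IntegrableOn.of_bound measure_Icc_lt_top
    (hf.measurable.comp (measurable_id.prodMk hy)).aestronglyMeasurable (C + L * M) ?_
  refine (ae_restrict_iff' measurableSet_Icc).2 (ae_of_all _ fun s hs => ?_)
  exact (hf.norm_le s (y s)).trans (by gcongr; exact hM s hs)

theorem intervalIntegrable [BorelSpace E] [SecondCountableTopology E] (hf : IsLipschitzField f L C)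
    (hL : 0 ≤ L) {y : ℝ → E} (hy : Continuous y) (a b : ℝ) :
    IntervalIntegrable (fun r => f r (y r)) volume a b := by
  obtain ⟨M, hM⟩ := (isCompact_uIcc (a := a) (b := b)).exists_bound_of_continuousOn hy.continuousOn
  exact (hf.integrableOn hL (a := min a b) (b := max a b) hy.measurable hM).intervalIntegrable

theorem intervalIntegrable_of_continuousOn [BorelSpace E] [SecondCountableTopology E]
    (hf : IsLipschitzField f L C) (hL : 0 ≤ L) {y : ℝ → E} {a b : ℝ} (hy : ContinuousOn y (uIcc a b)) :
    IntervalIntegrable (fun r => f r (y r)) volume a b := by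
  set z : ℝ → E := IccExtend (min_le_max (a := a) (b := b)) ((Icc (min a b) (max a b)).domRestrict y) with hz
  refine (hf.intervalIntegrable hL (y := z) (ContinuousOn.domRestrict hy).Icc_extend' a b).congr fun s hs => ?_
  have hs' : s ∈ Icc (min a b) (max a b) := uIoc_subset_uIcc hs
  rw [hz, IccExtend_of_mem _ _ hs', domRestrict_apply]

variable [NormedSpace ℝ E]

/-- A priori bound for solutions of the integral equation. -/
theorem norm_solution_le (hf : IsLipschitzField f L C) (hL : 0 ≤ L) (hC : 0 ≤ C) {y : ℝ → E}
    {b : ℝ} {x : E} (hb : 0 ≤ b) (hyc : ContinuousOn y (uIcc 0 b))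
    (hy : ∀ s ∈ uIcc 0 b, y s = x + ∫ r in (0 : ℝ)..s, f r (y r)) :
    ‖y b‖ ≤ (‖x‖ + C * b) * Real.exp (L * b) := by
  have h := le_mul_exp_of_le_add_mul_abs_integral (w := fun s => ‖y s‖) (δ := ‖x‖ + C * b)
    (L := L) (a := 0) (b := b) (by positivity) hL hyc.norm (fun s _ => norm_nonneg _) fun s hs => ?_
  · simpa [abs_of_nonneg hb] using h
  have hsub : uIcc 0 s ⊆ uIcc 0 b := uIcc_subset_uIcc_left hs
  rw [uIcc_of_le hb] at hs
  have hi : IntervalIntegrable (fun r => L * ‖y r‖) volume 0 s :=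
    ((hyc.norm.mono hsub).const_mul L).intervalIntegrable
  have h1 : ‖∫ r in (0 : ℝ)..s, f r (y r)‖ ≤ ∫ r in (0 : ℝ)..s, (C + L * ‖y r‖) :=
    intervalIntegral.norm_integral_le_of_norm_le hs.1
      (ae_of_all _ fun r _ => hf.norm_le r _) (intervalIntegrable_const.add hi)
  rw [intervalIntegral.integral_add intervalIntegrable_const hi,
    intervalIntegral.integral_const_mul, intervalIntegral.integral_const, sub_zero,
    smul_eq_mul] at h1
  have h2 : ‖y s‖ ≤ ‖x‖ + ‖∫ r in (0 : ℝ)..s, f r (y r)‖ := by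
    conv_lhs => rw [hy s (by rwa [uIcc_of_le hb])]
    exact norm_add_le _ _
  have h3 := mul_le_mul_of_nonneg_left (le_abs_self (∫ r in (0 : ℝ)..s, ‖y r‖)) hL
  have h4 := mul_le_mul_of_nonneg_left hs.2 hC
  rw [mul_comm] at h1
  nlinarith

variable [BorelSpace E] [SecondCountableTopology E]

/-- Two solutions of the integral equation started at time `a` diverge at most exponentially. -/
theorem norm_sub_le (hf : IsLipschitzField f L C) (hL : 0 ≤ L) {y z : ℝ → E} {a b : ℝ} {x x' : E}
    (hyc : ContinuousOn y (uIcc a b)) (hzc : ContinuousOn z (uIcc a b))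
    (hy : ∀ s ∈ uIcc a b, y s = x + ∫ r in a..s, f r (y r))
    (hz : ∀ s ∈ uIcc a b, z s = x' + ∫ r in a..s, f r (z r)) :
    ‖y b - z b‖ ≤ ‖x - x'‖ * Real.exp (L * |b - a|) := by
  refine le_mul_exp_of_le_add_mul_abs_integral (w := fun s => ‖y s - z s‖) (norm_nonneg _) hL
    (hyc.sub hzc).norm (fun s _ => norm_nonneg _) fun s hs => ?_
  have hsub : uIcc a s ⊆ uIcc a b := uIcc_subset_uIcc_left hs
  rw [hy s hs, hz s hs, add_sub_add_comm, ← intervalIntegral.integral_sub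
    (hf.intervalIntegrable_of_continuousOn hL (hyc.mono hsub))
    (hf.intervalIntegrable_of_continuousOn hL (hzc.mono hsub))]
  refine (norm_add_le _ _).trans (add_le_add le_rfl ?_)
  have h1 : ‖∫ r in a..s, (f r (y r) - f r (z r))‖ ≤ |∫ r in a..s, L * ‖y r - z r‖| :=
    intervalIntegral.norm_integral_le_abs_of_norm_le
      (ae_of_all _ fun r => hf.lipschitz r _ _)
      (((hyc.sub hzc).norm.mono hsub).const_mul L |>.intervalIntegrable)
  rwa [intervalIntegral.integral_const_mul, abs_mul, abs_of_nonneg hL] at h1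

/-- Global existence for the integral equation started at an arbitrary time of `[0, T]`. -/
theorem exists_solution [CompleteSpace E] (hf : IsLipschitzField f L C) (hL : 0 ≤ L) {T t₀ : ℝ}
    (ht₀ : t₀ ∈ Icc 0 T) (x : E) :
    ∃ y : ℝ → E, Continuous y ∧ ∀ s ∈ Icc 0 T, y s = x + ∫ r in t₀..s, f r (y r) := by
  have hT : (0 : ℝ) ≤ T := ht₀.1.trans ht₀.2
  have hcont : ∀ α : C(Icc 0 T, E), Continuous (IccExtend hT α) := fun α => α.continuous.Icc_extend'
  set Φ : C(Icc 0 T, E) → C(Icc 0 T, E) := fun α =>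
    { toFun := fun s => x + ∫ r in t₀..s, f r (IccExtend hT α r)
      continuous_toFun := by
        have := intervalIntegral.continuous_primitive (hf.intervalIntegrable hL (hcont α)) t₀
        fun_prop } with hΦ
  have hΦa : ∀ α s, Φ α s = x + ∫ r in t₀..(s : ℝ), f r (IccExtend hT α r) := fun _ _ => rfl
  have hiter : ∀ (k : ℕ) (α β : C(Icc 0 T, E)) (s : Icc 0 T),
      ‖Φ^[k] α s - Φ^[k] β s‖ ≤ (L * |s - t₀|) ^ k / k.factorial * dist α β := by
    intro k α β
    induction k with
    | zero =>
      intro s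
      simpa [dist_eq_norm] using ContinuousMap.dist_apply_le_dist (f := α) (g := β) s
    | succ k ih =>
      intro s
      rw [Function.iterate_succ_apply', Function.iterate_succ_apply', hΦa, hΦa,
        add_sub_add_left_eq_sub, ← intervalIntegral.integral_sub
          (hf.intervalIntegrable hL (hcont _) _ _) (hf.intervalIntegrable hL (hcont _) _ _)]
      calc _ ≤ ∫ r in uIoc t₀ s.1, L ^ (k + 1) / k.factorial * dist α β * |r - t₀| ^ k := by
            rw [intervalIntegral.norm_intervalIntegral_eq]
            apply norm_integral_le_of_norm_le (Continuous.integrableOn_uIoc (by fun_prop))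
            refine (ae_restrict_iff' measurableSet_uIoc).2 (ae_of_all _ fun r hr => ?_)
            have hr' : r ∈ Icc 0 T := uIcc_subset_Icc ht₀ s.2 (uIoc_subset_uIcc hr)
            refine (hf.lipschitz r _ _).trans ?_
            rw [IccExtend_of_mem _ _ hr', IccExtend_of_mem _ _ hr']
            refine (mul_le_mul_of_nonneg_left (ih ⟨r, hr'⟩) hL).trans (le_of_eq ?_)
            rw [mul_pow]
            ring
        _ = _ := by
            rw [integral_const_mul, integral_pow_abs_sub_uIoc, Nat.factorial_succ]
            push_cast
            field_simp
            ring
  obtain ⟨k, hk⟩ := FloorSemiring.tendsto_pow_div_factorial_atTop (L * T)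
    |>.eventually (gt_mem_nhds zero_lt_one) |>.exists
  have hc0 : 0 ≤ (L * T) ^ k / k.factorial := by positivity
  have hcontr : ContractingWith ⟨(L * T) ^ k / k.factorial, hc0⟩ (Φ^[k]) := by
    refine ⟨hk, LipschitzWith.of_dist_le_mul fun α β => ?_⟩
    refine (ContinuousMap.dist_le (by positivity)).2 fun s => ?_
    rw [dist_eq_norm]
    refine (hiter k α β s).trans ?_
    change _ ≤ (L * T) ^ k / k.factorial * dist α β
    have : |s - t₀| ≤ T := abs_sub_le_iff.2
      ⟨by linarith [s.2.2, ht₀.1], by linarith [s.2.1, ht₀.2]⟩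
    gcongr
  have : Nonempty C(Icc 0 T, E) := ⟨0⟩
  have hfix := hcontr.isFixedPt_fixedPoint_iterate
  set α := hcontr.fixedPoint
  refine ⟨IccExtend hT α, hcont α, fun s hs => ?_⟩
  rw [← hΦa α ⟨s, hs⟩, hfix, IccExtend_of_mem _ _ hs]

/-- Any function satisfying the integral equation from time `0`, with no regularity assumed, agrees
with a given continuous solution. -/
theorem eqOn_solution (hf : IsLipschitzField f L C) (hL : 0 ≤ L) {T : ℝ} {x : E} {y z : ℝ → E}
    (hzc : Continuous z) (hz : ∀ s ∈ Icc 0 T, z s = x + ∫ r in (0 : ℝ)..s, f r (z r))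
    (hy : ∀ s ∈ Icc 0 T, y s = x + ∫ r in (0 : ℝ)..s, f r (y r)) :
    EqOn y z (Icc 0 T) := by
  have hint : ∀ s ∈ Icc 0 T, IntervalIntegrable (fun r => f r (y r)) volume 0 s → y s = z s := by
    intro s hs hi
    have hsub : uIcc 0 s ⊆ Icc 0 T := uIcc_subset_Icc ⟨le_rfl, hs.1.trans hs.2⟩ hs
    have hyc : ContinuousOn y (uIcc 0 s) :=
      ((intervalIntegral.continuousOn_primitive_interval' hi left_mem_uIcc).const_add x).congr
        fun r hr => hy r (hsub hr)
    have h := hf.norm_sub_le hL hyc hzc.continuousOn (fun r hr => hy r (hsub hr))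
      (fun r hr => hz r (hsub hr))
    rw [sub_self, norm_zero, zero_mul] at h
    exact sub_eq_zero.1 (norm_le_zero_iff.1 h)
  intro s hs
  classical
  set S : Set ℝ := {r | 0 ≤ r ∧ IntervalIntegrable (fun r => f r (y r)) volume 0 r} with hS
  have hSm : MeasurableSet S := by
    refine OrdConnected.measurableSet ⟨fun p hp q hq r hr => ⟨hp.1.trans hr.1, hq.2.mono_set ?_⟩⟩
    rw [uIcc_of_le (hp.1.trans hr.1), uIcc_of_le hq.1]
    exact Icc_subset_Icc_right hr.2
  set v : ℝ → E := S.piecewise z fun _ => x with hv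
  have hvm : Measurable v := hzc.measurable.piecewise hSm measurable_const
  have hyv : EqOn y v (Icc 0 T) := by
    intro r hr
    by_cases hrS : r ∈ S
    · rw [hv, piecewise_eq_of_mem _ _ _ hrS, hint r hr hrS.2]
    · rw [hv, piecewise_eq_of_notMem _ _ _ hrS, hy r hr, intervalIntegral.integral_undef, add_zero]
      exact fun h => hrS ⟨hr.1, h⟩
  obtain ⟨M, hM⟩ := (isCompact_Icc (a := 0) (b := T)).exists_bound_of_continuousOn hzc.continuousOn
  have hvM : ∀ r ∈ Icc 0 T, ‖v r‖ ≤ max M ‖x‖ := by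
    intro r hr
    by_cases hrS : r ∈ S
    · rw [hv, piecewise_eq_of_mem _ _ _ hrS]
      exact (hM r hr).trans (le_max_left _ _)
    · rw [hv, piecewise_eq_of_notMem _ _ _ hrS]
      exact le_max_right _ _
  have hyI : IntegrableOn (fun r => f r (y r)) (Icc 0 T) :=
    (hf.integrableOn hL hvm hvM).congr_fun (fun r hr => by simp only [hyv hr]) measurableSet_Icc
  refine hint s hs (IntegrableOn.intervalIntegrable (hyI.mono_set ?_))
  exact uIcc_subset_Icc ⟨le_rfl, hs.1.trans hs.2⟩ hs

end IsLipschitzField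

theorem IsTraj.congr {n m : ℕ} {F : EucSp n → EucSp m → EucSp n} {d d' : ℝ → EucSp m} {t T : ℝ}
    {x : EucSp n} {y : ℝ → EucSp n} (h : IsTraj F d t T x y) (hd : EqOn d d' (Icc t T)) :
    IsTraj F d' t T x y := by
  refine ⟨h.1, fun s hs => ?_⟩
  rw [h.2 s hs]
  congr 1
  refine intervalIntegral.integral_congr fun r hr => ?_
  rw [uIcc_of_le hs.1] at hr
  simp only [hd ⟨hr.1, hr.2.trans hs.2⟩]

/-- Well-posedness of the controlled dynamics on `[0, T]`, with growth constants `A` and `K` that do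
not depend on the uncertainty. -/
structure IsWellPosed {n m : ℕ} (F : EucSp n → EucSp m → EucSp n) (D : Set (EucSp m))
    (T A K : ℝ) : Prop where
  pos : 0 < K
  continuousOn : ∀ {d x y}, Admissible D 0 T d → IsTraj F d 0 T x y → ContinuousOn y (Icc 0 T)
  norm_le : ∀ {d x y}, Admissible D 0 T d → IsTraj F d 0 T x y →
    ∀ s ∈ Icc 0 T, ‖y s‖ ≤ (‖x‖ + A) * K
  norm_sub_le : ∀ {d x x' y z}, Admissible D 0 T d → IsTraj F d 0 T x y → IsTraj F d 0 T x' z →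
    ∀ s ∈ Icc 0 T, ‖y s - z s‖ ≤ ‖x - x'‖ * K
  exists_traj : ∀ {d}, Admissible D 0 T d → ∀ x, ∃ y, IsTraj F d 0 T x y
  exists_traj_through : ∀ {d x y}, Admissible D 0 T d → IsTraj F d 0 T x y →
    ∀ s ∈ Icc 0 T, ∀ q, ∃ x' z, IsTraj F d 0 T x' z ∧ z s = q ∧ ‖x - x'‖ ≤ ‖y s - q‖ * K

theorem exists_isWellPosed {n m : ℕ} {T : ℝ} (hT : 0 < T) {D : Set (EucSp m)} (hDne : D.Nonempty)
    (hDcomp : IsCompact D) {F : EucSp n → EucSp m → EucSp n}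
    (hFcont : Continuous fun p : EucSp n × EucSp m => F p.1 p.2) {LF : ℝ} (hLF : 0 ≤ LF)
    (hFlip : ∀ x y : EucSp n, ∀ d ∈ D, ‖F x d - F y d‖ ≤ LF * ‖x - y‖) :
    ∃ A K, IsWellPosed F D T A K := by
  classical
  obtain ⟨d₀, hd₀⟩ := hDne
  obtain ⟨C, hC⟩ := hDcomp.exists_bound_of_continuousOn (f := fun d => F 0 d) (by fun_prop)
  have hC0 : 0 ≤ C := (norm_nonneg _).trans (hC d₀ hd₀)
  have hT0 : (0 : ℝ) ∈ Icc 0 T := ⟨le_rfl, hT.le⟩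
  have hext : ∀ {d}, Admissible D 0 T d → ∃ d', EqOn d d' (Icc 0 T) ∧
      IsLipschitzField (fun t x => F x (d' t)) LF C := by
    intro d hd
    have hmem : ∀ s, (Icc 0 T).piecewise d (fun _ => d₀) s ∈ D := by
      intro s
      by_cases hs : s ∈ Icc 0 T
      · rw [piecewise_eq_of_mem _ _ _ hs]
        exact hd.2 s hs
      · rwa [piecewise_eq_of_notMem _ _ _ hs]
    refine ⟨(Icc 0 T).piecewise d fun _ => d₀, fun s hs => (piecewise_eq_of_mem _ _ _ hs).symm,
      ?_, ?_, ?_⟩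
    · exact hFcont.measurable.comp (measurable_snd.prodMk
        ((hd.1.piecewise measurableSet_Icc measurable_const).comp measurable_fst))
    · exact fun t x y => hFlip x y _ (hmem t)
    · exact fun t => hC _ (hmem t)
  have hsub : ∀ {s}, s ∈ Icc 0 T → uIcc 0 s ⊆ Icc 0 T := fun hs => uIcc_subset_Icc hT0 hs
  have hexp : ∀ {a b : ℝ}, a ∈ Icc 0 T → b ∈ Icc 0 T →
      Real.exp (LF * |b - a|) ≤ Real.exp (LF * T) := by
    intro a b ha hb
    have : |b - a| ≤ T := abs_sub_le_iff.2 ⟨by linarith [hb.2, ha.1], by linarith [hb.1, ha.2]⟩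
    gcongr
  have hsol : ∀ {d}, IsLipschitzField (fun t x => F x (d t)) LF C → ∀ x,
      ∃ z, Continuous z ∧ IsTraj F d 0 T x z := by
    intro d hf x
    obtain ⟨z, hzc, hz⟩ := hf.exists_solution hLF hT0 x
    exact ⟨z, hzc, by simpa using hz 0 hT0, hz⟩
  have hcont : ∀ {d x y}, IsLipschitzField (fun t x => F x (d t)) LF C → IsTraj F d 0 T x y →
      ContinuousOn y (Icc 0 T) := by
    intro d x y hf hy
    obtain ⟨z, hzc, hz⟩ := hsol hf x
    exact hzc.continuousOn.congr (hf.eqOn_solution hLF hzc hz.2 hy.2)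
  refine ⟨C * T, Real.exp (LF * T), Real.exp_pos _, ?_, ?_, ?_, ?_, ?_⟩
  · intro d x y hd hy
    obtain ⟨d', hdd, hf⟩ := hext hd
    exact hcont hf (hy.congr hdd)
  · intro d x y hd hy s hs
    obtain ⟨d', hdd, hf⟩ := hext hd
    have hy' := hy.congr hdd
    refine (hf.norm_solution_le hLF hC0 hs.1 ((hcont hf hy').mono (hsub hs))
      fun r hr => hy'.2 r (hsub hs hr)).trans ?_
    have := hs.2
    gcongr
  · intro d x x' y z hd hy hz s hs
    obtain ⟨d', hdd, hf⟩ := hext hd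
    have hy' := hy.congr hdd
    have hz' := hz.congr hdd
    refine (hf.norm_sub_le hLF ((hcont hf hy').mono (hsub hs)) ((hcont hf hz').mono (hsub hs))
      (fun r hr => hy'.2 r (hsub hs hr)) fun r hr => hz'.2 r (hsub hs hr)).trans ?_
    exact mul_le_mul_of_nonneg_left (hexp hT0 hs) (norm_nonneg _)
  · intro d hd x
    obtain ⟨d', hdd, hf⟩ := hext hd
    obtain ⟨z, -, hz⟩ := hsol hf x
    exact ⟨z, hz.congr hdd.symm⟩
  · intro d x y hd hy s hs q
    obtain ⟨d', hdd, hf⟩ := hext hd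
    have hy' := hy.congr hdd
    have hyc := hcont hf hy'
    obtain ⟨z, hzc, hz⟩ := hf.exists_solution hLF hs q
    have hzs : z s = q := by simpa using hz s hs
    have hshift : ∀ {v : ℝ → EucSp n} {p q a b}, ContinuousOn v (Icc 0 T) → a ∈ Icc 0 T →
        b ∈ Icc 0 T → (∀ r ∈ Icc 0 T, v r = p + ∫ τ in a..r, F (v τ) (d' τ)) → v b = q →
        ∀ r ∈ Icc 0 T, v r = q + ∫ τ in b..r, F (v τ) (d' τ) := by
      intro v p q a b hvc ha hb hv hq r hr
      have hi : ∀ {r₁ r₂}, r₁ ∈ Icc 0 T → r₂ ∈ Icc 0 T →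
          IntervalIntegrable (fun τ => F (v τ) (d' τ)) volume r₁ r₂ := fun h₁ h₂ =>
        hf.intervalIntegrable_of_continuousOn hLF (hvc.mono (uIcc_subset_Icc h₁ h₂))
      rw [hv r hr, ← hq, hv b hb, add_assoc,
        intervalIntegral.integral_add_adjacent_intervals (hi ha hb) (hi hb hr)]
    refine ⟨z 0, z, IsTraj.congr (d := d')
      ⟨rfl, hshift hzc.continuousOn hs hT0 hz rfl⟩ hdd.symm, hzs, ?_⟩
    have hys := hshift hyc hT0 hs hy'.2 rfl
    have hs0 : uIcc s 0 ⊆ Icc 0 T := uIcc_subset_Icc hs hT0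
    have h := hf.norm_sub_le hLF (hyc.mono hs0) hzc.continuousOn (fun r hr => hys r (hs0 hr))
      fun r hr => hz r (hs0 hr)
    rw [hy.1] at h
    exact h.trans (mul_le_mul_of_nonneg_left (hexp hs hT0) (norm_nonneg _))

section Payoff

variable {n nX nTR : ℕ} {g : Fin nX → EucSp n → ℝ → ℝ} {l : Fin nTR → EucSp n → ℝ} {T : ℝ}
  {y : ℝ → EucSp n}

theorem continuousOn_constraint (hg : ∀ i, Continuous fun p : EucSp n × ℝ => g i p.1 p.2)
    (hy : ContinuousOn y (Icc 0 T)) (i : Fin nX) :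
    ContinuousOn (fun s => g i (y s) s) (Icc 0 T) :=
  (hg i).comp_continuousOn (hy.prodMk continuousOn_id)

theorem payoff_le_iff (hnX : 0 < nX) (hnTR : 0 < nTR) (hT : 0 ≤ T)
    (hg : ∀ i, Continuous fun p : EucSp n × ℝ => g i p.1 p.2) (hy : ContinuousOn y (Icc 0 T))
    {c : ℝ} :
    payoff g l 0 T y ≤ c ↔ (∀ j, l j (y T) ≤ c) ∧ ∀ i, ∀ s ∈ Icc 0 T, g i (y s) s ≤ c := by
  have : Nonempty (Fin nX) := ⟨⟨0, hnX⟩⟩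
  have : Nonempty (Fin nTR) := ⟨⟨0, hnTR⟩⟩
  rw [payoff, max_le_iff, ciSup_le_iff (finite_range _).bddAbove,
    ciSup_le_iff (finite_range _).bddAbove]
  refine and_congr Iff.rfl (forall_congr' fun i => ?_)
  rw [csSup_le_iff (isCompact_Icc.image_of_continuousOn
    (continuousOn_constraint hg hy i)).bddAbove ((nonempty_Icc.2 hT).image _), forall_mem_image]

theorem exists_eq_payoff (hnX : 0 < nX) (hnTR : 0 < nTR) (hT : 0 ≤ T)
    (hg : ∀ i, Continuous fun p : EucSp n × ℝ => g i p.1 p.2) (hy : ContinuousOn y (Icc 0 T)) :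
    (∃ j, l j (y T) = payoff g l 0 T y) ∨
      ∃ i, ∃ s ∈ Icc 0 T, g i (y s) s = payoff g l 0 T y := by
  have : Nonempty (Fin nX) := ⟨⟨0, hnX⟩⟩
  have : Nonempty (Fin nTR) := ⟨⟨0, hnTR⟩⟩
  obtain ⟨j, hj⟩ := exists_eq_ciSup_of_finite (f := fun j => l j (y T))
  obtain ⟨i, hi⟩ := exists_eq_ciSup_of_finite
    (f := fun i => sSup ((fun s => g i (y s) s) '' Icc 0 T))
  rcases max_choice (⨆ j, l j (y T)) (⨆ i, sSup ((fun s => g i (y s) s) '' Icc 0 T)) with h | h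
  · exact Or.inl ⟨j, by rw [payoff, h, ← hj]⟩
  · obtain ⟨s, hs, hsi⟩ := isCompact_Icc.exists_sSup_image_eq (nonempty_Icc.2 hT)
      (continuousOn_constraint hg hy i)
    exact Or.inr ⟨i, s, hs, by rw [payoff, h, ← hi, ← hsi]⟩

/-- The payoff depends continuously on the trajectory, uniformly on bounded sets. -/
theorem exists_payoff_le_add (hnX : 0 < nX) (hnTR : 0 < nTR) (hT : 0 ≤ T)
    (hg : ∀ i, Continuous fun p : EucSp n × ℝ => g i p.1 p.2) (hl : ∀ j, Continuous (l j))
    (M : ℝ) {ε : ℝ} (hε : 0 < ε) :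
    ∃ η > 0, ∀ y z : ℝ → EucSp n, ContinuousOn y (Icc 0 T) → ContinuousOn z (Icc 0 T) →
      (∀ s ∈ Icc 0 T, ‖y s‖ ≤ M) → (∀ s ∈ Icc 0 T, ‖z s‖ ≤ M) →
      (∀ s ∈ Icc 0 T, ‖y s - z s‖ < η) → payoff g l 0 T y ≤ payoff g l 0 T z + ε := by
  have hK : IsCompact (Metric.closedBall (0 : EucSp n) M) := isCompact_closedBall _ _
  have hG : UniformContinuousOn (fun p : EucSp n × ℝ => fun i => g i p.1 p.2)
      (Metric.closedBall (0 : EucSp n) M ×ˢ Icc 0 T) :=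
    (hK.prod isCompact_Icc).uniformContinuousOn_of_continuous (continuous_pi hg).continuousOn
  have hΛ : UniformContinuousOn (fun p : EucSp n => fun j => l j p)
      (Metric.closedBall (0 : EucSp n) M) :=
    hK.uniformContinuousOn_of_continuous (continuous_pi hl).continuousOn
  obtain ⟨η₁, hη₁, h₁⟩ := Metric.uniformContinuousOn_iff.1 hG ε hε
  obtain ⟨η₂, hη₂, h₂⟩ := Metric.uniformContinuousOn_iff.1 hΛ ε hε
  refine ⟨min η₁ η₂, lt_min hη₁ hη₂, fun y z hyc hzc hy hz hyz => ?_⟩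
  obtain ⟨hzl, hzg⟩ := (payoff_le_iff (l := l) hnX hnTR hT hg hzc).1 le_rfl
  have hTT : T ∈ Icc 0 T := ⟨hT, le_rfl⟩
  refine (payoff_le_iff hnX hnTR hT hg hyc).2 ⟨fun j => ?_, fun i s hs => ?_⟩
  · have h := (dist_le_pi_dist _ _ j).trans_lt (h₂ (y T) (mem_closedBall_zero_iff.2 (hy T hTT))
      (z T) (mem_closedBall_zero_iff.2 (hz T hTT))
      (by rw [dist_eq_norm]; exact (hyz T hTT).trans_le (min_le_right _ _)))
    rw [Real.dist_eq] at h
    linarith [(abs_lt.1 h).2, hzl j]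
  · have h := (dist_le_pi_dist _ _ i).trans_lt (h₁ (y s, s)
      ⟨mem_closedBall_zero_iff.2 (hy s hs), hs⟩ (z s, s) ⟨mem_closedBall_zero_iff.2 (hz s hs), hs⟩
      (by
        rw [Prod.dist_eq, dist_self, max_eq_left dist_nonneg, dist_eq_norm]
        exact (hyz s hs).trans_le (min_le_left _ _)))
    rw [Real.dist_eq] at h
    linarith [(abs_lt.1 h).2, hzg i s hs]

end Payoff

section Value

variable {n m nX nTR : ℕ} {T A K : ℝ} {D : Set (EucSp m)} {F : EucSp n → EucSp m → EucSp n}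
  {g : Fin nX → EucSp n → ℝ → ℝ} {l : Fin nTR → EucSp n → ℝ} {u : EucSp n → ℝ → ℝ}

theorem IsValueFun.payoff_le (hu : IsValueFun F D g l T u) (hwp : IsWellPosed F D T A K)
    (hnX : 0 < nX) (hnTR : 0 < nTR) (hT : 0 ≤ T)
    (hg : ∀ i, Continuous fun p : EucSp n × ℝ => g i p.1 p.2) (hl : ∀ j, Continuous (l j))
    {d : ℝ → EucSp m} {x : EucSp n} {y : ℝ → EucSp n} (hd : Admissible D 0 T d)
    (hy : IsTraj F d 0 T x y) : payoff g l 0 T y ≤ u x 0 := by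
  rw [hu x 0 ⟨le_rfl, hT⟩]
  refine le_csSup ?_ ⟨d, y, hd, hy, rfl⟩
  set M := (‖x‖ + A) * K
  have hK : IsCompact (Metric.closedBall (0 : EucSp n) M) := isCompact_closedBall _ _
  obtain ⟨c₁, hc₁⟩ := (hK.prod (isCompact_Icc (a := 0) (b := T))).exists_bound_of_continuousOn
    (continuous_pi hg).continuousOn
  obtain ⟨c₂, hc₂⟩ := hK.exists_bound_of_continuousOn (continuous_pi hl).continuousOn
  refine ⟨max c₁ c₂, ?_⟩
  rintro _ ⟨d, y, hd, hy, rfl⟩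
  have hM := hwp.norm_le hd hy
  refine (payoff_le_iff hnX hnTR hT hg (hwp.continuousOn hd hy)).2 ⟨fun j => ?_, fun i s hs => ?_⟩
  · exact (le_abs_self _).trans <| (norm_le_pi_norm (fun j => l j (y T)) j).trans <|
      (hc₂ (y T) (mem_closedBall_zero_iff.2 (hM T ⟨hT, le_rfl⟩))).trans (le_max_right _ _)
  · exact (le_abs_self _).trans <| (norm_le_pi_norm (fun i => g i (y s) s) i).trans <|
      (hc₁ (y s, s) ⟨mem_closedBall_zero_iff.2 (hM s hs), hs⟩).trans (le_max_left _ _)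

theorem IsValueFun.continuous (hu : IsValueFun F D g l T u) (hwp : IsWellPosed F D T A K)
    (hnX : 0 < nX) (hnTR : 0 < nTR) (hT : 0 ≤ T)
    (hg : ∀ i, Continuous fun p : EucSp n × ℝ => g i p.1 p.2) (hl : ∀ j, Continuous (l j))
    (hatt : ∀ x : EucSp n, ∃ d y, Admissible D 0 T d ∧ IsTraj F d 0 T x y ∧
      u x 0 = payoff g l 0 T y) : Continuous fun x => u x 0 := by
  refine continuous_iff_continuousAt.2 fun x => Metric.continuousAt_iff.2 fun ε hε => ?_
  set M := (‖x‖ + 1 + A) * K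
  obtain ⟨η, hη, h⟩ := exists_payoff_le_add hnX hnTR hT hg hl M (half_pos hε)
  have hK := hwp.pos
  have key : ∀ p q : EucSp n, ‖p‖ ≤ ‖x‖ + 1 → ‖q‖ ≤ ‖x‖ + 1 → ‖p - q‖ < η / K →
      u p 0 ≤ u q 0 + ε / 2 := by
    intro p q hp hq hpq
    obtain ⟨d, y, hd, hy, hup⟩ := hatt p
    obtain ⟨z, hz⟩ := hwp.exists_traj hd q
    have h1 := h y z (hwp.continuousOn hd hy) (hwp.continuousOn hd hz)
      (fun s hs => (hwp.norm_le hd hy s hs).trans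
        (mul_le_mul_of_nonneg_right (by linarith) hK.le))
      (fun s hs => (hwp.norm_le hd hz s hs).trans
        (mul_le_mul_of_nonneg_right (by linarith) hK.le))
      (fun s hs => (hwp.norm_sub_le hd hy hz s hs).trans_lt ((lt_div_iff₀ hK).1 hpq))
    linarith [hu.payoff_le hwp hnX hnTR hT hg hl hd hz]
  refine ⟨min 1 (η / K), lt_min one_pos (div_pos hη hK), fun {x'} hx' => ?_⟩
  rw [dist_eq_norm] at hx'
  have h1 := hx'.trans_le (min_le_left _ _)
  have h2 := hx'.trans_le (min_le_right _ _)
  have hx1 : ‖x'‖ ≤ ‖x‖ + 1 := by linarith [norm_le_norm_add_norm_sub' x' x]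
  have ha := key x' x hx1 (by linarith) h2
  have hb := key x x' (by linarith) hx1 (by rwa [norm_sub_rev])
  rw [Real.dist_eq, abs_lt]
  constructor <;> linarith

theorem IsValueFun.frontier_eq (hu : IsValueFun F D g l T u) (hwp : IsWellPosed F D T A K)
    (hnX : 0 < nX) (hnTR : 0 < nTR) (hT : 0 ≤ T)
    (hg : ∀ i, Continuous fun p : EucSp n × ℝ => g i p.1 p.2) (hl : ∀ j, Continuous (l j))
    (hfrX : ∀ t ∈ Icc (0 : ℝ) T, frontier {x : EucSp n | ∀ i, g i x t ≤ 0} =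
      ⋃ i, {x : EucSp n | (∀ i', g i' x t ≤ 0) ∧ g i x t = 0})
    (hfrTR : frontier {x : EucSp n | ∀ j, l j x ≤ 0} =
      ⋃ j, {x : EucSp n | (∀ j', l j' x ≤ 0) ∧ l j x = 0})
    (hatt : ∀ x : EucSp n, ∃ d y, Admissible D 0 T d ∧ IsTraj F d 0 T x y ∧
      u x 0 = payoff g l 0 T y) :
    frontier {x : EucSp n | u x 0 ≤ 0} = {x : EucSp n | u x 0 = 0} := by
  have huc := hu.continuous hwp hnX hnTR hT hg hl hatt
  refine (frontier_le_subset_eq huc continuous_const).antisymm fun x (hx : u x 0 = 0) => ?_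
  refine ⟨subset_closure hx.le, fun hint => ?_⟩
  obtain ⟨r, hr, hball⟩ := Metric.mem_nhds_iff.1 (mem_interior_iff_mem_nhds.1 hint)
  obtain ⟨d, y, hd, hy, hup⟩ := hatt x
  rw [hx] at hup
  have hyc := hwp.continuousOn hd hy
  have hK := hwp.pos
  -- Points near `y s` are reached at time `s` from points near `x`, which still have payoff `≤ 0`.
  have hnear : ∀ s ∈ Icc 0 T, ∀ q ∈ Metric.ball (y s) (r / K),
      ∃ z : ℝ → EucSp n, z s = q ∧ (∀ j, l j (z T) ≤ 0) ∧ ∀ i, ∀ τ ∈ Icc 0 T, g i (z τ) τ ≤ 0 := by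
    intro s hs q hq
    obtain ⟨x', z, hz, hzs, hxx⟩ := hwp.exists_traj_through hd hy s hs q
    rw [Metric.mem_ball', dist_eq_norm, lt_div_iff₀ hK] at hq
    have hx' : u x' 0 ≤ 0 := hball (by
      rw [Metric.mem_ball', dist_eq_norm]
      exact hxx.trans_lt hq)
    exact ⟨z, hzs, (payoff_le_iff hnX hnTR hT hg (hwp.continuousOn hd hz)).1
      ((hu.payoff_le hwp hnX hnTR hT hg hl hd hz).trans hx')⟩
  have hTT : T ∈ Icc 0 T := ⟨hT, le_rfl⟩
  obtain ⟨hyl, hyg⟩ := (payoff_le_iff (l := l) hnX hnTR hT hg hyc).1 hup.ge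
  rcases exists_eq_payoff (l := l) hnX hnTR hT hg hyc with ⟨j, hj⟩ | ⟨i, s, hs, hi⟩
  · have hfr : y T ∈ frontier {x : EucSp n | ∀ j, l j x ≤ 0} := by
      rw [hfrTR]
      exact mem_iUnion.2 ⟨j, hyl, hj.trans hup.symm⟩
    refine hfr.2 (mem_interior_iff_mem_nhds.2
      (mem_of_superset (Metric.ball_mem_nhds _ (div_pos hr hK)) fun q hq => ?_))
    obtain ⟨z, rfl, hzl, -⟩ := hnear T hTT q hq
    exact hzl
  · have hfr : y s ∈ frontier {x : EucSp n | ∀ i, g i x s ≤ 0} := by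
      rw [hfrX s hs]
      exact mem_iUnion.2 ⟨i, fun i' => hyg i' s hs, hi.trans hup.symm⟩
    refine hfr.2 (mem_interior_iff_mem_nhds.2
      (mem_of_superset (Metric.ball_mem_nhds _ (div_pos hr hK)) fun q hq => ?_))
    obtain ⟨z, rfl, -, hzg⟩ := hnear s hs q hq
    exact fun i' => hzg i' s hs

end Value

/-- Convergence in measure of the inner approximations
`X₀ₖ = {x ∈ X₀ | ψₖ(x) ≤ 0}` to the interior of `ℛ₀ = {x | u(x,0) ≤ 0}`. -/
theorem stmt14
    {n m nX nTR : ℕ} (hn : 0 < n) (hm : 0 < m) (hnX : 0 < nX) (hnTR : 0 < nTR)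
    (T : ℝ) (hT : 0 < T)
    (D : Set (EucSp m)) (hDne : D.Nonempty) (hDcomp : IsCompact D)
    (F : EucSp n → EucSp m → EucSp n)
    (hFcont : Continuous fun p : EucSp n × EucSp m => F p.1 p.2)
    (LF : ℝ) (hLF : 0 ≤ LF)
    (hFlip : ∀ x y : EucSp n, ∀ d ∈ D, ‖F x d - F y d‖ ≤ LF * ‖x - y‖)
    (g : Fin nX → EucSp n → ℝ → ℝ) (l : Fin nTR → EucSp n → ℝ)
    (hg : ∀ i, LocallyLipschitz fun p : EucSp n × ℝ => g i p.1 p.2)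
    (hl : ∀ j, LocallyLipschitz (l j))
    (u : EucSp n → ℝ → ℝ) (hu : IsValueFun F D g l T u)
    (R : ℝ) (hR : 0 < R)
    (Bset : Set (EucSp n)) (hB : Bset = {x : EucSp n | ∑ i, x i ^ 2 ≤ R})
    (hXB : ∀ t ∈ Set.Icc (0:ℝ) T, {x : EucSp n | ∀ i, g i x t ≤ 0} ⊆ Bset)
    (hTRB : {x : EucSp n | ∀ j, l j x ≤ 0} ⊆ Bset)
    (hfrX : ∀ t ∈ Set.Icc (0:ℝ) T, frontier {x : EucSp n | ∀ i, g i x t ≤ 0} =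
      ⋃ i, {x : EucSp n | (∀ i', g i' x t ≤ 0) ∧ g i x t = 0})
    (hfrTR : frontier {x : EucSp n | ∀ j, l j x ≤ 0} =
      ⋃ j, {x : EucSp n | (∀ j', l j' x ≤ 0) ∧ l j x = 0})
    (hatt : ∀ x : EucSp n, ∃ d y, Admissible D 0 T d ∧ IsTraj F d 0 T x y ∧
      u x 0 = payoff g l 0 T y)
    (ψ : ℕ → EucSp n → ℝ)
    (hψcont : ∀ k, ContinuousOn (ψ k) Bset)
    (hψgt : ∀ k, ∀ x ∈ Bset, u x 0 < ψ k x)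
    (hψconv : Tendsto (fun k => sSup ((fun x => |ψ k x - u x 0|) '' Bset))
      atTop (𝓝 0)) :
    frontier {x : EucSp n | u x 0 ≤ 0} = {x : EucSp n | u x 0 = 0} ∧
    Tendsto
      (fun k => volume ({x : EucSp n | u x 0 ≤ 0} \
        {x : EucSp n | (∀ i, g i x 0 ≤ 0) ∧ ψ k x ≤ 0}))
      atTop (𝓝 (volume (frontier {x : EucSp n | u x 0 ≤ 0}))) := by
  obtain ⟨A, K, hwp⟩ := exists_isWellPosed hT hDne hDcomp hFcont hLF hFlip
  have hgc : ∀ i, Continuous fun p : EucSp n × ℝ => g i p.1 p.2 := fun i => (hg i).continuous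
  have hlc : ∀ j, Continuous (l j) := fun j => (hl j).continuous
  have huc := hu.continuous hwp hnX hnTR hT.le hgc hlc hatt
  have hfr := hu.frontier_eq hwp hnX hnTR hT.le hgc hlc hfrX hfrTR hatt
  refine ⟨hfr, ?_⟩
  rw [hfr]
  have h0 : (0 : ℝ) ∈ Icc 0 T := ⟨le_rfl, hT.le⟩
  have hX0 : ∀ x, u x 0 ≤ 0 → ∀ i, g i x 0 ≤ 0 := by
    intro x hx i
    obtain ⟨d, y, hd, hy, hup⟩ := hatt x
    have h := ((payoff_le_iff hnX hnTR hT.le hgc (hwp.continuousOn hd hy)).1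
      (hup.symm.trans_le hx)).2 i 0 h0
    rwa [hy.1] at h
  have hRB : ∀ x, u x 0 ≤ 0 → x ∈ Bset := fun x hx => hXB 0 h0 (hX0 x hx)
  have hBclosed : IsClosed Bset := by
    rw [hB]
    exact isClosed_le (by fun_prop) continuous_const
  have hBcomp : IsCompact Bset := by
    refine Metric.isCompact_of_isClosed_isBounded hBclosed
      (Metric.isBounded_closedBall.subset (fun x hx => ?_) (t := Metric.closedBall 0 (√R)))
    rw [hB] at hx
    rw [mem_closedBall_zero_iff, EuclideanSpace.norm_eq]
    exact Real.sqrt_le_sqrt (by simpa using hx)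
  have hRclosed : IsClosed {x : EucSp n | u x 0 ≤ 0} := isClosed_le huc continuous_const
  refine tendsto_measure_of_tendsto_indicator atTop (fun k => ?_) hBclosed.measurableSet
    hBcomp.measure_ne_top (Eventually.of_forall fun k x hx => hRB x hx.1) fun x => ?_
  · have hX : IsClosed {x : EucSp n | ∀ i, g i x 0 ≤ 0} := by
      simp only [ofPred_forall]
      exact isClosed_iInter fun i => isClosed_le
        ((hgc i).comp (continuous_id.prodMk continuous_const)) continuous_const
    have hψ : IsClosed (Bset ∩ ψ k ⁻¹' Iic 0) :=
      (hψcont k).preimage_isClosed_of_isClosed hBclosed isClosed_Iic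
    have hdiff : {x : EucSp n | u x 0 ≤ 0} \ {x | (∀ i, g i x 0 ≤ 0) ∧ ψ k x ≤ 0} =
        {x | u x 0 ≤ 0} \ ({x | ∀ i, g i x 0 ≤ 0} ∩ (Bset ∩ ψ k ⁻¹' Iic 0)) := by
      ext x
      exact ⟨fun h => ⟨h.1, fun h' => h.2 ⟨h'.1, h'.2.2⟩⟩,
        fun h => ⟨h.1, fun h' => h.2 ⟨h'.1, hRB x h.1, h'.2⟩⟩⟩
    rw [hdiff]
    exact hRclosed.measurableSet.diff (hX.measurableSet.inter hψ.measurableSet)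
  · rcases lt_trichotomy (u x 0) 0 with hx | hx | hx
    · filter_upwards [hψconv.eventually (gt_mem_nhds (neg_pos.2 hx))] with k hk
      refine iff_of_false (fun h => h.2 ⟨hX0 x hx.le, ?_⟩) hx.ne
      have hxB := hRB x hx.le
      have hle : |ψ k x - u x 0| ≤ sSup ((fun x => |ψ k x - u x 0|) '' Bset) :=
        le_csSup (hBcomp.image_of_continuousOn
          ((hψcont k).sub huc.continuousOn).abs).bddAbove (mem_image_of_mem _ hxB)
      linarith [le_abs_self (ψ k x - u x 0)]
    · exact Eventually.of_forall fun k => iff_of_true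
        ⟨hx.le, fun h => absurd h.2 (not_le.2 (hx ▸ hψgt k x (hRB x hx.le)))⟩ hx
    · exact Eventually.of_forall fun k => iff_of_false (fun h => not_le.2 hx h.1) hx.ne'

end
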